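/- For every r₀ ∈ (0,1) there exist constants c̃ > 0 and c̃' ≥ 0, depending only on r₀, such that for all r ∈ (−1,1) and all m ∈ [−1+r₀, 1−r₀] one has f₀(r)(r − m) ≥ c̃ |f₀(r)| − c̃', where f₀(r) := ln(1+r) − ln(1−r). -/

import Mathlib

open Set

theorem f0_aux_pos (r₀ r m : ℝ) (h0 : 0 < r₀) (h1 : r₀ < 1) (hr : 0 ≤ r) (hr1 : r < 1)
    (hm : m ≤ 1 - r₀) :
    r₀ / 2 * |Real.log (1 + r) - Real.log (1 - r)|
        - (Real.log (1 + (1 - r₀ / 2)) - Real.log (1 - (1 - r₀ / 2))) ≤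
      (Real.log (1 + r) - Real.log (1 - r)) * (r - m) := by
  have hg : 0 ≤ Real.log (1 + r) - Real.log (1 - r) :=
    sub_nonneg.2 (Real.log_le_log (by linarith) (by linarith))
  have hM : 0 ≤ Real.log (1 + (1 - r₀ / 2)) - Real.log (1 - (1 - r₀ / 2)) :=
    sub_nonneg.2 (Real.log_le_log (by linarith) (by linarith))
  rw [abs_of_nonneg hg]
  rcases le_total (1 - r₀ / 2) r with h | h
  · have := mul_nonneg hg (show 0 ≤ r - m - r₀ / 2 by linarith)
    linarith
  · have a1 : Real.log (1 + r) ≤ Real.log (1 + (1 - r₀ / 2)) :=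
      Real.log_le_log (by linarith) (by linarith)
    have a2 : Real.log (1 - (1 - r₀ / 2)) ≤ Real.log (1 - r) :=
      Real.log_le_log (by linarith) (by linarith)
    have := mul_nonneg hg (show 0 ≤ r - m - r₀ / 2 + 1 by linarith)
    linarith

/-- **Uniform coercivity of `f₀` (inequality (6.x) / Statement 19).** For every
`r₀ ∈ (0,1)` there exist `c̃ > 0` and `c̃' ≥ 0`, depending only on `r₀`, such that
`f₀(r)(r − m) ≥ c̃ |f₀(r)| − c̃'` for all `r ∈ (−1,1)` and `m ∈ [−1+r₀, 1−r₀]`,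
where `f₀(r) = ln(1+r) − ln(1−r)`. -/
theorem f0_uniform_coercivity :
    ∀ r₀ ∈ Ioo (0:ℝ) 1, ∃ c > (0:ℝ), ∃ c' ≥ (0:ℝ),
      ∀ r ∈ Ioo (-1:ℝ) 1, ∀ m ∈ Icc (-1 + r₀) (1 - r₀),
        c * |Real.log (1 + r) - Real.log (1 - r)| - c' ≤
          (Real.log (1 + r) - Real.log (1 - r)) * (r - m) := by
  intro r₀ ⟨h0, h1⟩
  refine ⟨r₀ / 2, by linarith, Real.log (1 + (1 - r₀ / 2)) - Real.log (1 - (1 - r₀ / 2)),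
    sub_nonneg.2 (Real.log_le_log (by linarith) (by linarith)), ?_⟩
  rintro r ⟨hr, hr1⟩ m ⟨hm, hm1⟩
  rcases le_total 0 r with h | h
  · exact f0_aux_pos r₀ r m h0 h1 h hr1 hm1
  · have := f0_aux_pos r₀ (-r) (-m) h0 h1 (by linarith) (by linarith) (by linarith)
    rw [← sub_eq_add_neg 1 r, sub_neg_eq_add 1 r, abs_sub_comm] at this
    linarith
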